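/- arXiv:1801.04956 — 3 statements merged into one kernel-verified Lean document; each statement's English description precedes it below -/
import Mathlib

section
/- Let I be the ideal of R generated by x2^{a12}x4^{a14}, x2^{a2} − x1^{a21}x3^{a23}, x3^{a3} − x1^{a31}x4^{a34}, x4^{a4}, x3^{a23}x4^{a14}. Then the sequence 0 → R^2 →(φ3) R^6 →(φ2) R^5 →(φ1) R → R/I → 0 is exact, and it is a minimal free resolution of R/I. Here φ1 = (x2^{a12}x4^{a14}, x2^{a2}−x1^{a21}x3^{a23}, x3^{a3}−x1^{a31}x4^{a34}, x4^{a4}, x3^{a23}x4^{a14}); φ2 is the 5×6 matrix with rows (x3^{a23}, x2^{a42}, x4^{a34}, 0, 0, 0), (0, −x4^{a14}, 0, 0, 0, x3^{a3}−x1^{a31}x4^{a34}), (0, 0, 0, −x4^{a14}, 0, −x2^{a2}+x1^{a21}x3^{a23}), (0, 0, −x2^{a12}, −x1^{a31}, −x3^{a23}, 0), (−x2^{a12}, −x1^{a21}, 0, x3^{a43}, x4^{a34}, 0); and φ3 is the 6×2 matrix with rows (x4^{a34}, x2^{a42}x3^{a43}), (0, −x3^{a3}+x1^{a31}x4^{a34}),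 (−x3^{a23}, −x1^{a31}x2^{a42}), (0, x2^{a2}−x1^{a21}x3^{a23}), (x2^{a12}, x1^{a1}), (0, −x4^{a14}), where a1 = a21+a31. -/
open MvPolynomial Matrix

/-- Multiplication by `a` is injective on the quotient by `J`. -/
def RegularMod {R : Type*} [CommRing R] (J : Ideal R) (a : R) : Prop :=
  ∀ w, a * w ∈ J → w ∈ J

namespace RegularMod

variable {R : Type*} [CommRing R] {J : Ideal R} {a b p : R}

theorem pow (h : RegularMod J a) (n : ℕ) : RegularMod J (a ^ n) := by
  induction n with
  | zero => intro w hw; simpa using hw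
  | succ n ih => intro w hw; exact h w (ih _ (by rwa [← mul_assoc, ← pow_succ]))

theorem congr (h : RegularMod J a) (hab : a - b ∈ J) : RegularMod J b := by
  intro w hw
  apply h
  have := J.add_mem hw (J.mul_mem_right w hab)
  rwa [← add_mul, add_sub_cancel] at this

theorem bot [IsDomain R] (ha : a ≠ 0) : RegularMod ⊥ a := by
  intro w hw
  simpa [ha] using hw

/-- If `p, a` is regular modulo `J`, then so is `p ^ n, a`. -/
theorem span_pow_sup (hp : RegularMod J p) (ha : RegularMod (Ideal.span {p} ⊔ J) a) (n : ℕ) :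
    RegularMod (Ideal.span {p ^ n} ⊔ J) a := by
  induction n with
  | zero => intro w _; simp
  | succ n ih =>
    intro w hw
    obtain ⟨c, j, hj, hc⟩ := Ideal.mem_span_singleton_sup.1 hw
    obtain ⟨d, i, hi, hd⟩ := Ideal.mem_span_singleton_sup.1
      (ih w (Ideal.mem_span_singleton_sup.2 ⟨c * p, j, hj, by rw [← hc]; ring⟩))
    have h1 : p ^ n * (a * d - c * p) ∈ J := by
      have : p ^ n * (a * d - c * p) = j - a * i := by linear_combination a * hd - hc
      rw [this]
      exact J.sub_mem hj (J.mul_mem_left a hi)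
    obtain ⟨e, l, hl, he⟩ := Ideal.mem_span_singleton_sup.1 (ha d
      (Ideal.mem_span_singleton_sup.2 ⟨c, _, hp.pow n _ h1, by ring⟩))
    exact Ideal.mem_span_singleton_sup.2
      ⟨e, p ^ n * l + i, J.add_mem (J.mul_mem_left _ hl) hi, by
        linear_combination hd + p ^ n * he⟩

/-- If `a, b` is regular modulo `J`, then `a` is regular modulo `J` and `b`. -/
theorem swap (ha : RegularMod J a) (hb : RegularMod (Ideal.span {a} ⊔ J) b) :
    RegularMod (Ideal.span {b} ⊔ J) a := by
  intro w hw
  obtain ⟨c, j, hj, hc⟩ := Ideal.mem_span_singleton_sup.1 hw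
  obtain ⟨d, i, hi, hd⟩ := Ideal.mem_span_singleton_sup.1
    (hb c (Ideal.mem_span_singleton_sup.2 ⟨w, -j, J.neg_mem hj, by linear_combination -hc⟩))
  have h1 : a * (w - d * b) ∈ J := by
    have : a * (w - d * b) = b * i + j := by linear_combination -hc - b * hd
    rw [this]
    exact J.add_mem (J.mul_mem_left b hi) hj
  exact Ideal.mem_span_singleton_sup.2 ⟨d, _, ha _ h1, by ring⟩

theorem span_pow [IsDomain R] (hp : p ≠ 0) (ha : RegularMod (Ideal.span {p}) a) (n : ℕ) :
    RegularMod (Ideal.span {p ^ n}) a := by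
  have := span_pow_sup (bot hp) (by rwa [sup_bot_eq]) n
  rwa [sup_bot_eq] at this

end RegularMod

namespace MvPolynomial

variable {σ k : Type*} [Field k]

theorem regularMod_span_X {i j : σ} (h : i ≠ j) :
    RegularMod (Ideal.span {(X i : MvPolynomial σ k)}) (X j) := by
  intro w hw
  rw [Ideal.mem_span_singleton] at hw ⊢
  exact (X_prime.dvd_or_dvd hw).resolve_left fun hd => h (X_dvd_X.1 hd)

theorem regularMod_span_X_sup {i j l : σ} (hi : i ≠ l) (hj : j ≠ l) :
    RegularMod (Ideal.span {(X i : MvPolynomial σ k)} ⊔ Ideal.span {X j}) (X l) := by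
  have hs : Ideal.span {(X i : MvPolynomial σ k)} ⊔ Ideal.span {X j} =
      Ideal.span (X '' {i, j}) := by
    rw [Set.image_pair, Ideal.span_insert]
  rw [hs]
  intro w hw
  rw [mem_ideal_span_X_image] at hw ⊢
  intro m hm
  obtain ⟨n, hn, h0⟩ := hw (Finsupp.single l 1 + m) (by
    rw [support_X_mul]
    exact Finset.mem_map_of_mem _ hm)
  refine ⟨n, hn, ?_⟩
  have hnl : l ≠ n := by
    rcases hn with rfl | rfl
    exacts [hi.symm, hj.symm]
  simpa [Finsupp.single_apply, hnl] using h0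

end MvPolynomial

namespace TangentConeResolution

variable {R : Type*} [CommRing R]

/-- The presentation matrix of the ideal, with the monomial entries as parameters. -/
def relations (A A' B B' C C' D D' : R) : Matrix (Fin 5) (Fin 6) R :=
  !![C, B', D', 0, 0, 0;
    0, -D, 0, 0, 0, C * C' - A' * D';
    0, 0, 0, -D, 0, -(B * B') + A * C;
    0, 0, -B, -A', -C, 0;
    -B, -A, 0, C', D', 0]

/-- The second syzygy matrix, with the monomial entries as parameters. -/
def syzygies (A A' B B' C C' D D' : R) : Matrix (Fin 6) (Fin 2) R :=
  !![D', B' * C';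
    0, -(C * C') + A' * D';
    -C, -(A' * B');
    0, B * B' - A * C;
    B, A * A';
    0, -D]

/-- The generators of the ideal, with the monomial entries as parameters. -/
def generators (A A' B B' C C' D D' : R) : Fin 5 → R :=
  ![B * D, B * B' - A * C, C * C' - A' * D', D * D', C * D]

variable {A A' B B' C C' D D' : R}

theorem relations_mulVec (u : Fin 6 → R) :
    relations A A' B B' C C' D D' *ᵥ u =
      ![C * u 0 + B' * u 1 + D' * u 2,
        -(D * u 1) + (C * C' - A' * D') * u 5,
        -(D * u 3) + (-(B * B') + A * C) * u 5,
        -(B * u 2) - A' * u 3 - C * u 4,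
        -(B * u 0) - A * u 1 + C' * u 3 + D' * u 4] := by
  ext i
  fin_cases i <;> simp [relations, mulVec, dotProduct, Fin.sum_univ_six] <;> ring

theorem syzygies_mulVec (t : Fin 2 → R) :
    syzygies A A' B B' C C' D D' *ᵥ t =
      ![D' * t 0 + B' * C' * t 1,
        (-(C * C') + A' * D') * t 1,
        -(C * t 0) - A' * B' * t 1,
        (B * B' - A * C) * t 1,
        B * t 0 + A * A' * t 1,
        -(D * t 1)] := by
  ext i
  fin_cases i <;> simp [syzygies, mulVec, dotProduct, Fin.sum_univ_two]
  ring

theorem generators_mem {m : Ideal R} (hA : A ∈ m) (hA' : A' ∈ m) (hB : B ∈ m) (hC : C ∈ m)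
    (hD : D ∈ m) (i : Fin 5) : generators A A' B B' C C' D D' i ∈ m := by
  fin_cases i
  · exact m.mul_mem_right _ hB
  · exact m.sub_mem (m.mul_mem_right _ hB) (m.mul_mem_right _ hA)
  · exact m.sub_mem (m.mul_mem_right _ hC) (m.mul_mem_right _ hA')
  · exact m.mul_mem_right _ hD
  · exact m.mul_mem_right _ hC

theorem relations_mem {m : Ideal R} (hA : A ∈ m) (hA' : A' ∈ m) (hB : B ∈ m) (hB' : B' ∈ m)
    (hC : C ∈ m) (hC' : C' ∈ m) (hD : D ∈ m) (hD' : D' ∈ m) (i : Fin 5) (j : Fin 6) :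
    relations A A' B B' C C' D D' i j ∈ m := by
  fin_cases i <;> fin_cases j <;>
    simp [relations, m.sub_mem, m.add_mem, m.neg_mem, m.mul_mem_right, *]

theorem syzygies_mem {m : Ideal R} (hA : A ∈ m) (hA' : A' ∈ m) (hB : B ∈ m) (hB' : B' ∈ m)
    (hC : C ∈ m) (hD : D ∈ m) (hD' : D' ∈ m) (i : Fin 6) (j : Fin 2) :
    syzygies A A' B B' C C' D D' i j ∈ m := by
  fin_cases i <;> fin_cases j <;>
    simp [syzygies, m.sub_mem, m.add_mem, m.neg_mem, m.mul_mem_right, *]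

variable [IsDomain R]

theorem syzygies_injective (hD : D ≠ 0) (hD' : D' ≠ 0) :
    Function.Injective (syzygies A A' B B' C C' D D').mulVecLin := by
  rw [injective_iff_map_eq_zero]
  intro t ht
  rw [mulVecLin_apply, syzygies_mulVec] at ht
  have h0 := congrFun ht 0
  have h5 := congrFun ht 5
  simp only [cons_val, Pi.zero_apply, neg_eq_zero, mul_eq_zero, hD, false_or] at h0 h5
  simp only [h5, mul_zero, add_zero, mul_eq_zero, hD', false_or] at h0
  ext i
  fin_cases i <;> simp [h0, h5]

theorem exact_syzygies_relations (hD : D ≠ 0) (hD' : D' ≠ 0)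
    (h3 : RegularMod (Ideal.span {D}) (C * C' - A' * D'))
    (hC : RegularMod (Ideal.span {D'}) C) (hC0 : C ≠ 0) :
    Function.Exact (syzygies A A' B B' C C' D D').mulVecLin
      (relations A A' B B' C C' D D').mulVecLin := by
  intro u
  simp only [mulVecLin_apply]
  constructor
  · intro hu
    rw [relations_mulVec] at hu
    have e0 := congrFun hu 0
    have e1 := congrFun hu 1
    have e2 := congrFun hu 2
    have e3 := congrFun hu 3
    have e4 := congrFun hu 4
    simp only [cons_val, Pi.zero_apply] at e0 e1 e2 e3 e4
    obtain ⟨s, hs⟩ := Ideal.mem_span_singleton.1 (h3 (u 5)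
      (Ideal.mem_span_singleton.2 ⟨u 1, by linear_combination e1⟩))
    have h1 : u 1 = (C * C' - A' * D') * s := mul_left_cancel₀ hD (by
      linear_combination -e1 + (C * C' - A' * D') * hs)
    have h3 : u 3 = (-(B * B') + A * C) * s := mul_left_cancel₀ hD (by
      linear_combination -e2 + (-(B * B') + A * C) * hs)
    obtain ⟨t, ht⟩ := Ideal.mem_span_singleton.1 (hC (u 0 + B' * C' * s)
      (Ideal.mem_span_singleton.2 ⟨-u 2 + A' * B' * s, by
        linear_combination e0 - B' * h1⟩))
    have h2 : u 2 = -(C * t) + A' * B' * s := mul_left_cancel₀ hD' (by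
      linear_combination e0 - B' * h1 - C * ht)
    have h4 : u 4 = B * t - A * A' * s := mul_left_cancel₀ hC0 (by
      linear_combination -e3 - B * h2 - A' * h3)
    refine ⟨![t, -s], ?_⟩
    rw [mulVecLin_apply, syzygies_mulVec]
    ext i
    fin_cases i <;> simp only [Fin.mk_zero, Fin.mk_one, Fin.reduceFinMk, cons_val]
    · linear_combination -ht
    · linear_combination -h1
    · linear_combination -h2
    · linear_combination -h3
    · linear_combination -h4
    · linear_combination -hs
  · rintro ⟨t, rfl⟩
    rw [mulVecLin_apply, syzygies_mulVec, relations_mulVec]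
    ext i
    fin_cases i <;> simp <;> ring

theorem exact_relations_generators (hD : D ≠ 0) (hD' : D' ≠ 0)
    (h3 : RegularMod (Ideal.span {D}) (C * C' - A' * D'))
    (h2 : RegularMod (Ideal.span {D} ⊔ Ideal.span {C * C' - A' * D'}) (B * B' - A * C))
    (hC : RegularMod (Ideal.span {D'}) C)
    (hB : RegularMod (Ideal.span {D'} ⊔ Ideal.span {C}) B)
    (φ : (Fin 5 → R) →ₗ[R] R)
    (hφ : ∀ v, φ v = ∑ i, v i * generators A A' B B' C C' D D' i) :
    Function.Exact (relations A A' B B' C C' D D').mulVecLin φ := by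
  intro v
  simp only [hφ, generators, Fin.sum_univ_five, cons_val]
  constructor
  · intro hv
    obtain ⟨q, _, hp, hq⟩ := Ideal.mem_span_singleton_sup.1 (h2 (v 1)
      (Ideal.mem_span_singleton_sup.2 ⟨-(v 0 * B + v 3 * D' + v 4 * C), _,
        Ideal.mem_span_singleton.2 ⟨-v 2, rfl⟩, by linear_combination -hv⟩))
    obtain ⟨p, rfl⟩ := Ideal.mem_span_singleton.1 hp
    obtain ⟨r, hr⟩ := Ideal.mem_span_singleton.1 (h3 (v 2 + p * (B * B' - A * C))
      (Ideal.mem_span_singleton.2 ⟨-(v 0 * B + v 3 * D' + v 4 * C + q * (B * B' - A * C)), by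
        linear_combination hv + (B * B' - A * C) * hq⟩))
    have hk : B * (v 0 + B' * q) + D' * (v 3 - A' * r) + C * (v 4 - A * q + C' * r) = 0 :=
      mul_left_cancel₀ hD (by
        linear_combination hv + (B * B' - A * C) * hq - (C * C' - A' * D') * hr)
    obtain ⟨a, _, hb, ha⟩ := Ideal.mem_span_singleton_sup.1 (hB (v 0 + B' * q)
      (Ideal.mem_span_singleton_sup.2 ⟨-(v 3 - A' * r), _,
        Ideal.mem_span_singleton.2 ⟨-(v 4 - A * q + C' * r), rfl⟩, by linear_combination -hk⟩))
    obtain ⟨b, rfl⟩ := Ideal.mem_span_singleton.1 hb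
    obtain ⟨c, hc⟩ := Ideal.mem_span_singleton.1 (hC (v 4 - A * q + C' * r + b * B)
      (Ideal.mem_span_singleton.2 ⟨-(v 3 - A' * r + a * B), by
        linear_combination hk + B * ha⟩))
    have h3 : v 3 - A' * r + a * B = -(C * c) := mul_left_cancel₀ hD' (by
      linear_combination hk + B * ha - C * hc)
    refine ⟨![b, -q, a, -r, c, p], ?_⟩
    rw [mulVecLin_apply, relations_mulVec]
    ext i
    fin_cases i <;> simp only [Fin.mk_zero, Fin.mk_one, Fin.reduceFinMk, cons_val]
    · linear_combination ha
    · linear_combination hq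
    · linear_combination -hr
    · linear_combination -h3
    · linear_combination -hc
  · rintro ⟨u, rfl⟩
    rw [mulVecLin_apply, relations_mulVec]
    simp only [cons_val]
    ring

end TangentConeResolution

theorem gorenstein_tangent_cone_resolution_case_3a_stmt13
    (k : Type*) [Field k]
    (a21 a31 a12 a42 a23 a43 a14 a34 a1 a2 a3 a4 : ℕ)
    (h21 : 0 < a21)
    (h31 : 0 < a31)
    (h12 : 0 < a12)
    (h42 : 0 < a42)
    (h23 : 0 < a23)
    (h43 : 0 < a43)
    (h14 : 0 < a14)
    (h34 : 0 < a34)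
    (ha1 : a1 = a21 + a31)
    (ha2 : a2 = a12 + a42)
    (ha3 : a3 = a23 + a43)
    (ha4 : a4 = a14 + a34)
    (hc1 : a12 + a14 < a1)
    (hc2 : a4 < a42 + a43)
    (hc3 : a2 ≤ a21 + a23)
    (hc4 : a3 ≤ a31 + a34)
    (x1 x2 x3 x4 : MvPolynomial (Fin 4) k)
    (hx1 : x1 = X 0) (hx2 : x2 = X 1) (hx3 : x3 = X 2) (hx4 : x4 = X 3)
    (I m : Ideal (MvPolynomial (Fin 4) k))
    (hI : I = Ideal.span {x2 ^ a12 * x4 ^ a14, x2 ^ a2 - x1 ^ a21 * x3 ^ a23, x3 ^ a3 - x1 ^ a31 * x4 ^ a34, x4 ^ a4, x3 ^ a23 * x4 ^ a14})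
    (hm : m = Ideal.span {x1, x2, x3, x4})
    (g : Fin 5 → MvPolynomial (Fin 4) k)
    (hg : g = ![x2 ^ a12 * x4 ^ a14, x2 ^ a2 - x1 ^ a21 * x3 ^ a23, x3 ^ a3 - x1 ^ a31 * x4 ^ a34, x4 ^ a4, x3 ^ a23 * x4 ^ a14])
    (φ1 : (Fin 5 → MvPolynomial (Fin 4) k) →ₗ[MvPolynomial (Fin 4) k]
      MvPolynomial (Fin 4) k)
    (hφ1 : ∀ v, φ1 v = ∑ i, v i * g i)
    (M2 : Matrix (Fin 5) (Fin 6) (MvPolynomial (Fin 4) k))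
    (hM2 : M2 = !![x3 ^ a23, x2 ^ a42, x4 ^ a34, 0, 0, 0;
      0, -x4 ^ a14, 0, 0, 0, x3 ^ a3 - x1 ^ a31 * x4 ^ a34;
      0, 0, 0, -x4 ^ a14, 0, -x2 ^ a2 + x1 ^ a21 * x3 ^ a23;
      0, 0, -x2 ^ a12, -x1 ^ a31, -x3 ^ a23, 0;
      -x2 ^ a12, -x1 ^ a21, 0, x3 ^ a43, x4 ^ a34, 0])
    (M3 : Matrix (Fin 6) (Fin 2) (MvPolynomial (Fin 4) k))
    (hM3 : M3 = !![x4 ^ a34, x2 ^ a42 * x3 ^ a43;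
      0, -x3 ^ a3 + x1 ^ a31 * x4 ^ a34;
      -x3 ^ a23, -(x1 ^ a31 * x2 ^ a42);
      0, x2 ^ a2 - x1 ^ a21 * x3 ^ a23;
      x2 ^ a12, x1 ^ a1;
      0, -x4 ^ a14]) :
    Function.Injective ⇑M3.mulVecLin ∧
    Function.Exact ⇑M3.mulVecLin ⇑M2.mulVecLin ∧
    Function.Exact ⇑M2.mulVecLin ⇑φ1 ∧
    LinearMap.range φ1 = I ∧
    Function.Surjective (Ideal.Quotient.mk I) ∧
    (∀ i, g i ∈ m) ∧ (∀ i j, M2 i j ∈ m) ∧ (∀ i j, M3 i j ∈ m) := by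
  have hg' : g = TangentConeResolution.generators (x1 ^ a21) (x1 ^ a31) (x2 ^ a12) (x2 ^ a42)
      (x3 ^ a23) (x3 ^ a43) (x4 ^ a14) (x4 ^ a34) := by
    rw [hg, ha2, ha3, ha4]
    simp only [TangentConeResolution.generators, pow_add]
  have hM2' : M2 = TangentConeResolution.relations (x1 ^ a21) (x1 ^ a31) (x2 ^ a12) (x2 ^ a42)
      (x3 ^ a23) (x3 ^ a43) (x4 ^ a14) (x4 ^ a34) := by
    rw [hM2, ha2, ha3]
    simp only [TangentConeResolution.relations, pow_add]
  have hM3' : M3 = TangentConeResolution.syzygies (x1 ^ a21) (x1 ^ a31) (x2 ^ a12) (x2 ^ a42)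
      (x3 ^ a23) (x3 ^ a43) (x4 ^ a14) (x4 ^ a34) := by
    rw [hM3, ha1, ha2, ha3]
    simp only [TangentConeResolution.syzygies, pow_add]
  have h3 : x3 ≠ 0 := hx3 ▸ X_ne_zero _
  have h4 : x4 ≠ 0 := hx4 ▸ X_ne_zero _
  have r43 : RegularMod (Ideal.span {x4}) x3 := by
    rw [hx3, hx4]; exact regularMod_span_X (by decide)
  have r34 : RegularMod (Ideal.span {x3}) x4 := by
    rw [hx3, hx4]; exact regularMod_span_X (by decide)
  have r432 : RegularMod (Ideal.span {x4} ⊔ Ideal.span {x3}) x2 := by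
    rw [hx2, hx3, hx4]; exact regularMod_span_X_sup (by decide) (by decide)
  have hC : RegularMod (Ideal.span {x4 ^ a34}) (x3 ^ a23) := (r43.span_pow h4 a34).pow a23
  have hB : RegularMod (Ideal.span {x4 ^ a34} ⊔ Ideal.span {x3 ^ a23}) (x2 ^ a12) := by
    have h := RegularMod.span_pow_sup r34 r432 a34
    rw [sup_comm] at h
    have h' := RegularMod.span_pow_sup (r43.span_pow h4 a34) h a23
    rw [sup_comm] at h'
    exact h'.pow a12
  set g2 := x2 ^ a12 * x2 ^ a42 - x1 ^ a21 * x3 ^ a23 with hg2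
  set g3 := x3 ^ a23 * x3 ^ a43 - x1 ^ a31 * x4 ^ a34 with hg3
  have hd : x3 ^ a3 - g3 ∈ Ideal.span {x4} := by
    rw [Ideal.mem_span_singleton, hg3, ha3, pow_add, sub_sub_cancel]
    exact (dvd_pow_self x4 h34.ne').mul_left _
  have r4g3 : RegularMod (Ideal.span {x4}) g3 := (r43.pow a3).congr hd
  have r43g2 : RegularMod (Ideal.span {x3} ⊔ Ideal.span {x4}) g2 := by
    rw [sup_comm] at r432
    refine (r432.pow a2).congr (Ideal.mem_sup_left ?_)
    rw [Ideal.mem_span_singleton, hg2, ha2, pow_add, sub_sub_cancel]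
    exact (dvd_pow_self x3 h23.ne').mul_left _
  have hg3reg : RegularMod (Ideal.span {x4 ^ a14}) g3 := r4g3.span_pow h4 a14
  have hg2reg : RegularMod (Ideal.span {x4 ^ a14} ⊔ Ideal.span {g3}) g2 := by
    refine RegularMod.span_pow_sup ?_ ?_ a14
    · have h := (RegularMod.bot h4).swap (b := g3) (by rwa [sup_bot_eq])
      rwa [sup_bot_eq] at h
    · have h := r43.span_pow_sup r43g2 a3
      have hs : Ideal.span {x4} ⊔ Ideal.span {g3} = Ideal.span {x3 ^ a3} ⊔ Ideal.span {x4} := by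
        obtain ⟨c, hc⟩ := Ideal.mem_span_singleton.1 hd
        rw [sup_comm, ← Ideal.span_insert, ← Ideal.span_insert,
          show g3 = x3 ^ a3 + -c * x4 by linear_combination -hc]
        exact Ideal.span_pair_add_mul_right _ _ _
      rwa [hs]
  have m1 : x1 ∈ m := hm ▸ Ideal.subset_span (by simp)
  have m2 : x2 ∈ m := hm ▸ Ideal.subset_span (by simp)
  have m3 : x3 ∈ m := hm ▸ Ideal.subset_span (by simp)
  have m4 : x4 ∈ m := hm ▸ Ideal.subset_span (by simp)
  have p1 {n : ℕ} (hn : 0 < n) : x1 ^ n ∈ m := m.pow_mem_of_mem m1 n hn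
  have p2 {n : ℕ} (hn : 0 < n) : x2 ^ n ∈ m := m.pow_mem_of_mem m2 n hn
  have p3 {n : ℕ} (hn : 0 < n) : x3 ^ n ∈ m := m.pow_mem_of_mem m3 n hn
  have p4 {n : ℕ} (hn : 0 < n) : x4 ^ n ∈ m := m.pow_mem_of_mem m4 n hn
  refine ⟨?_, ?_, ?_, ?_, Ideal.Quotient.mk_surjective, ?_, ?_, ?_⟩
  · rw [hM3']
    exact TangentConeResolution.syzygies_injective (pow_ne_zero _ h4) (pow_ne_zero _ h4)
  · rw [hM3', hM2']
    exact TangentConeResolution.exact_syzygies_relations (pow_ne_zero _ h4) (pow_ne_zero _ h4)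
      hg3reg hC (pow_ne_zero _ h3)
  · rw [hM2']
    exact TangentConeResolution.exact_relations_generators (pow_ne_zero _ h4) (pow_ne_zero _ h4)
      hg3reg hg2reg hC hB φ1 (hg' ▸ hφ1)
  · have hφ : φ1 = Fintype.linearCombination _ g := by
      refine LinearMap.ext fun v => ?_
      rw [hφ1, Fintype.linearCombination_apply]
      simp only [smul_eq_mul]
    rw [hφ, Fintype.range_linearCombination, hI, hg]
    simp only [range_cons, range_empty, Set.union_empty, Set.singleton_union]
  · rw [hg']
    exact TangentConeResolution.generators_mem (p1 h21) (p1 h31) (p2 h12) (p3 h23) (p4 h14)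
  · rw [hM2']
    exact TangentConeResolution.relations_mem (p1 h21) (p1 h31) (p2 h12) (p2 h42) (p3 h23)
      (p3 h43) (p4 h14) (p4 h34)
  · rw [hM3']
    exact TangentConeResolution.syzygies_mem (p1 h21) (p1 h31) (p2 h12) (p2 h42) (p3 h23)
      (p4 h14) (p4 h34)
end

section
/- Let I be the homogeneous ideal of R generated by x3^{a13}x4^{a14}, x2^{a2}, x3^{a3}, x4^{a4}, x2^{a32}x4^{a14}. Then for every i ≥ 0, the Hilbert function H(i) = dim_k (R/I)_i (dimension of the degree-i homogeneous component of R/I) equals C(i+3,3) − C(i−a13−a14+3,3) − C(i−a2+3,3) − C(i−a3+3,3) − C(i−a4+3,3) − C(i−a32−a14+3,3) + C(i−a3−a14+3,3) + C(i−a2−a3+3,3) + C(i−a4−a13+3,3) + C(i−a32−a13−a14+3,3) + C(i−a32−a4+3,3) + C(i−a14−a2+3,3) − C(i−a2−a3−a14+3,3) − C(i−a4−a13−a32+3,3), where C(m,3) denotes the binomial coefficient 'm choose 3' with the convention C(m,3) = 0 whenever m < 3. -/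
open MvPolynomial

/-- `choose3 m` is the binomial coefficient `m choose 3`, with the convention
that it is `0` whenever `m < 3` (in particular for negative `m`). -/
noncomputable def choose3 (m : ℤ) : ℤ := if m < 3 then 0 else (m.toNat.choose 3 : ℤ)

namespace MvPolynomial

/-- The monomials supported in `T` that do not lie in the monomial ideal generated by `G` form a
basis of the image of `restrictSupport k T` modulo that ideal. -/
theorem finrank_map_restrictSupport_quotient_span_monomial {σ k : Type*} [Field k]
    (G T : Set (σ →₀ ℕ)) :
    Module.finrank k (Submodule.map
        (Ideal.Quotient.mkₐ k (Ideal.span ((fun s => monomial s (1 : k)) '' G))).toLinearMap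
        (restrictSupport k T)) =
      Nat.card {s | s ∈ T ∧ ∀ g ∈ G, ¬ g ≤ s} := by
  classical
  set I := Ideal.span ((fun s => monomial s (1 : k)) '' G)
  set π := (Ideal.Quotient.mkₐ k I).toLinearMap
  set S : Set (σ →₀ ℕ) := {s | s ∈ T ∧ ∀ g ∈ G, ¬ g ≤ s}
  have hmem (p : MvPolynomial σ k) : π p = 0 ↔ ∀ s ∈ p.support, ∃ g ∈ G, g ≤ s := by
    rw [← mem_ideal_span_monomial_image]
    exact Ideal.Quotient.eq_zero_iff_mem
  have hmap : Submodule.map π (restrictSupport k T) = Submodule.map π (restrictSupport k S) := by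
    apply le_antisymm
    · rw [restrictSupport_eq_span, Submodule.map_span, Submodule.span_le]
      rintro _ ⟨_, ⟨s, hs, rfl⟩, rfl⟩
      by_cases h : ∀ g ∈ G, ¬ g ≤ s
      · exact Submodule.mem_map_of_mem ((monomial_mem_restrictSupport k).2 (.inl ⟨hs, h⟩))
      · push Not at h
        have h0 : π (monomial s 1) = 0 := (hmem _).2 fun t ht => by
          obtain rfl : t = s := Finset.mem_singleton.1 (support_monomial_subset ht)
          exact h
        rw [SetLike.mem_coe, h0]
        exact zero_mem _
    · exact Submodule.map_mono (restrictSupport_mono k fun s hs => hs.1)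
  have hinj : Function.Injective (π.domRestrict (restrictSupport k S)) := by
    rw [injective_iff_map_eq_zero]
    rintro ⟨p, hp⟩ h
    have h0 := (hmem p).1 h
    refine Subtype.ext (support_eq_empty.1 (Finset.eq_empty_of_forall_notMem fun s hs => ?_))
    obtain ⟨g, hg, hgs⟩ := h0 s hs
    exact ((mem_restrictSupport_iff k).1 hp hs).2 g hg hgs
  rw [hmap, ← LinearMap.range_domRestrict, LinearMap.finrank_range_of_inj hinj,
    Module.finrank_eq_nat_card_basis (basisRestrictSupport k S)]

end MvPolynomial

/-- The number of exponent vectors of degree `i` in four variables lying above `d`. -/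
theorem card_filter_le_finsuppAntidiag (d : Fin 4 →₀ ℕ) (i : ℕ) :
    (((Finset.univ.finsuppAntidiag i).filter (d ≤ ·)).card : ℤ) =
      choose3 ((i : ℤ) - (d.degree : ℤ) + 3) := by
  by_cases h : d.degree ≤ i
  · obtain ⟨n, rfl⟩ := Nat.exists_eq_add_of_le h
    have hset : (Finset.univ.finsuppAntidiag (d.degree + n)).filter (d ≤ ·) =
        (Finset.univ.finsuppAntidiag n).map (addLeftEmbedding d) := by
      ext s
      simp only [Finset.mem_filter, Finset.mem_finsuppAntidiag, Finset.subset_univ, and_true,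
        Finset.mem_map, addLeftEmbedding_apply, ← Finsupp.degree_eq_sum]
      constructor
      · rintro ⟨hs, hd⟩
        obtain ⟨t, rfl⟩ := exists_add_of_le hd
        exact ⟨t, by simpa using hs, rfl⟩
      · rintro ⟨t, ht, rfl⟩
        exact ⟨by simp [ht], le_self_add⟩
    have hn : ((d.degree + n : ℕ) : ℤ) - (d.degree : ℤ) + 3 = ((n + 3 : ℕ) : ℤ) := by
      push_cast; ring
    rw [hset, Finset.card_map, Finset.card_finsuppAntidiag_nat_eq_choose, hn, choose3,
      if_neg (by omega), Int.toNat_natCast, Finset.card_univ, Fintype.card_fin,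
      show 4 + n - 1 = n + 3 by omega, Nat.choose_symm_add]
  · rw [choose3, if_pos (by omega), Finset.filter_false_of_mem]
    · simp
    · intro s hs hd
      rw [Finset.mem_finsuppAntidiag, ← Finsupp.degree_eq_sum] at hs
      exact h (hs.1 ▸ Finsupp.degree_mono hd)

/-- The exponent vector of `x2 ^ b * x3 ^ c * x4 ^ d`. -/
noncomputable def expVec (b c d : ℕ) : Fin 4 →₀ ℕ :=
  Finsupp.equivFunOnFinite.symm ![0, b, c, d]

theorem expVec_le_iff (b c d : ℕ) (s : Fin 4 →₀ ℕ) :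
    expVec b c d ≤ s ↔ b ≤ s 1 ∧ c ≤ s 2 ∧ d ≤ s 3 := by
  simp [Finsupp.le_def, expVec, Fin.forall_fin_succ]

theorem degree_expVec (b c d : ℕ) : (expVec b c d).degree = b + c + d := by
  simp [Finsupp.degree_eq_sum, expVec, Fin.sum_univ_four]

theorem monomial_expVec {k : Type*} [Field k] (b c d : ℕ) :
    monomial (expVec b c d) (1 : k) = X 1 ^ b * X 2 ^ c * X 3 ^ d := by
  simp only [X_pow_eq_monomial, monomial_mul, mul_one]
  refine congrArg (monomial · 1) (Finsupp.ext fun j => ?_)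
  fin_cases j <;> simp [expVec]

/-- The number of exponent vectors of degree `i` lying above `expVec b c d`. -/
theorem sum_ite_expVec_le (b c d i : ℕ) :
    ∑ s ∈ Finset.univ.finsuppAntidiag i,
        (if b ≤ s (1 : Fin 4) ∧ c ≤ s 2 ∧ d ≤ s 3 then (1 : ℤ) else 0) =
      choose3 ((i : ℤ) - b - c - d + 3) := by
  simp_rw [← expVec_le_iff]
  rw [Finset.sum_boole]
  refine (card_filter_le_finsuppAntidiag _ _).trans ?_
  rw [degree_expVec]
  congr 1
  push_cast
  ring

/-- Inclusion-exclusion for the monomials outside the ideal, with `y`, `u`, `v` the exponents of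
the last three variables. -/
theorem indicator_staircase {a2 a32 a3 a13 a4 a14 y u v : ℕ}
    (h2 : a32 ≤ a2) (h3 : a13 ≤ a3) (h4 : a14 ≤ a4) :
    (if ¬ (0 ≤ y ∧ a13 ≤ u ∧ a14 ≤ v) ∧ ¬ (a2 ≤ y ∧ 0 ≤ u ∧ 0 ≤ v) ∧
        ¬ (0 ≤ y ∧ a3 ≤ u ∧ 0 ≤ v) ∧ ¬ (0 ≤ y ∧ 0 ≤ u ∧ a4 ≤ v) ∧
        ¬ (a32 ≤ y ∧ 0 ≤ u ∧ a14 ≤ v) then (1 : ℤ) else 0) =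
      (if 0 ≤ y ∧ 0 ≤ u ∧ 0 ≤ v then (1 : ℤ) else 0)
      - (if 0 ≤ y ∧ a13 ≤ u ∧ a14 ≤ v then (1 : ℤ) else 0)
      - (if a2 ≤ y ∧ 0 ≤ u ∧ 0 ≤ v then (1 : ℤ) else 0)
      - (if 0 ≤ y ∧ a3 ≤ u ∧ 0 ≤ v then (1 : ℤ) else 0)
      - (if 0 ≤ y ∧ 0 ≤ u ∧ a4 ≤ v then (1 : ℤ) else 0)
      - (if a32 ≤ y ∧ 0 ≤ u ∧ a14 ≤ v then (1 : ℤ) else 0)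
      + (if 0 ≤ y ∧ a3 ≤ u ∧ a14 ≤ v then (1 : ℤ) else 0)
      + (if a2 ≤ y ∧ a3 ≤ u ∧ 0 ≤ v then (1 : ℤ) else 0)
      + (if 0 ≤ y ∧ a13 ≤ u ∧ a4 ≤ v then (1 : ℤ) else 0)
      + (if a32 ≤ y ∧ a13 ≤ u ∧ a14 ≤ v then (1 : ℤ) else 0)
      + (if a32 ≤ y ∧ 0 ≤ u ∧ a4 ≤ v then (1 : ℤ) else 0)
      + (if a2 ≤ y ∧ 0 ≤ u ∧ a14 ≤ v then (1 : ℤ) else 0)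
      - (if a2 ≤ y ∧ a3 ≤ u ∧ a14 ≤ v then (1 : ℤ) else 0)
      - (if a32 ≤ y ∧ a13 ≤ u ∧ a4 ≤ v then (1 : ℤ) else 0) := by
  simp only [Nat.zero_le, true_and, and_true]
  have hy : a2 ≤ y ∧ a32 ≤ y ∨ ¬ a2 ≤ y ∧ a32 ≤ y ∨ ¬ a2 ≤ y ∧ ¬ a32 ≤ y := by omega
  have hu : a3 ≤ u ∧ a13 ≤ u ∨ ¬ a3 ≤ u ∧ a13 ≤ u ∨ ¬ a3 ≤ u ∧ ¬ a13 ≤ u := by omega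
  have hv : a4 ≤ v ∧ a14 ≤ v ∨ ¬ a4 ≤ v ∧ a14 ≤ v ∨ ¬ a4 ≤ v ∧ ¬ a14 ≤ v := by omega
  clear h2 h3 h4
  rcases hy with ⟨p2, p32⟩ | ⟨p2, p32⟩ | ⟨p2, p32⟩ <;>
    rcases hu with ⟨p3, p13⟩ | ⟨p3, p13⟩ | ⟨p3, p13⟩ <;>
    rcases hv with ⟨p4, p14⟩ | ⟨p4, p14⟩ | ⟨p4, p14⟩ <;>
    simp [p2, p32, p3, p13, p4, p14]

theorem hilbert_function_tangent_cone_case_1a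
    (k : Type*) [Field k]
    (a21 a31 a32 a42 a13 a43 a14 a24 a1 a2 a3 a4 : ℕ)
    (h21 : 0 < a21) (h31 : 0 < a31) (h32 : 0 < a32) (h42 : 0 < a42)
    (h13 : 0 < a13) (h43 : 0 < a43) (h14 : 0 < a14) (h24 : 0 < a24)
    (ha1 : a1 = a21 + a31) (ha2 : a2 = a32 + a42)
    (ha3 : a3 = a13 + a43) (ha4 : a4 = a14 + a24)
    (hc1 : a13 + a14 < a1) (hc2 : a4 < a42 + a43)
    (hc3 : a3 < a31 + a32) (hc4 : a2 ≤ a21 + a24)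
    (x1 x2 x3 x4 : MvPolynomial (Fin 4) k)
    (hx1 : x1 = X 0) (hx2 : x2 = X 1) (hx3 : x3 = X 2) (hx4 : x4 = X 3)
    (I : Ideal (MvPolynomial (Fin 4) k))
    (hI : I = Ideal.span {x3 ^ a13 * x4 ^ a14, x2 ^ a2, x3 ^ a3, x4 ^ a4,
      x2 ^ a32 * x4 ^ a14}) :
    ∀ i : ℕ,
      (Module.finrank k
        (Submodule.map (Ideal.Quotient.mkₐ k I).toLinearMap
          (homogeneousSubmodule (Fin 4) k i)) : ℤ) =
      choose3 ((i : ℤ) + 3)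
        - choose3 ((i : ℤ) - (a13 : ℤ) - (a14 : ℤ) + 3)
        - choose3 ((i : ℤ) - (a2 : ℤ) + 3)
        - choose3 ((i : ℤ) - (a3 : ℤ) + 3)
        - choose3 ((i : ℤ) - (a4 : ℤ) + 3)
        - choose3 ((i : ℤ) - (a32 : ℤ) - (a14 : ℤ) + 3)
        + choose3 ((i : ℤ) - (a3 : ℤ) - (a14 : ℤ) + 3)
        + choose3 ((i : ℤ) - (a2 : ℤ) - (a3 : ℤ) + 3)
        + choose3 ((i : ℤ) - (a4 : ℤ) - (a13 : ℤ) + 3)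
        + choose3 ((i : ℤ) - (a32 : ℤ) - (a13 : ℤ) - (a14 : ℤ) + 3)
        + choose3 ((i : ℤ) - (a32 : ℤ) - (a4 : ℤ) + 3)
        + choose3 ((i : ℤ) - (a14 : ℤ) - (a2 : ℤ) + 3)
        - choose3 ((i : ℤ) - (a2 : ℤ) - (a3 : ℤ) - (a14 : ℤ) + 3)
        - choose3 ((i : ℤ) - (a4 : ℤ) - (a13 : ℤ) - (a32 : ℤ) + 3) := by
  classical
  intro i
  obtain ⟨G, hG⟩ : ∃ G : Set (Fin 4 →₀ ℕ), G = {expVec 0 a13 a14, expVec a2 0 0,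
      expVec 0 a3 0, expVec 0 0 a4, expVec a32 0 a14} := ⟨_, rfl⟩
  have hspan : I = Ideal.span ((fun s => monomial s (1 : k)) '' G) := by
    subst hI hG hx2 hx3 hx4
    simp [Set.image_insert_eq, monomial_expVec]
  have hstd (s : Fin 4 →₀ ℕ) : (∀ g ∈ G, ¬ g ≤ s) ↔
      ¬ (0 ≤ s 1 ∧ a13 ≤ s 2 ∧ a14 ≤ s 3) ∧ ¬ (a2 ≤ s 1 ∧ 0 ≤ s 2 ∧ 0 ≤ s 3) ∧
        ¬ (0 ≤ s 1 ∧ a3 ≤ s 2 ∧ 0 ≤ s 3) ∧ ¬ (0 ≤ s 1 ∧ 0 ≤ s 2 ∧ a4 ≤ s 3) ∧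
        ¬ (a32 ≤ s 1 ∧ 0 ≤ s 2 ∧ a14 ≤ s 3) := by
    simp only [hG, Set.mem_insert_iff, Set.mem_singleton_iff, forall_eq_or_imp, forall_eq,
      expVec_le_iff]
  have hset : {s : Fin 4 →₀ ℕ | s ∈ {s : Fin 4 →₀ ℕ | s.degree = i} ∧ ∀ g ∈ G, ¬ g ≤ s} =
      ((Finset.univ.finsuppAntidiag i).filter fun s : Fin 4 →₀ ℕ => ∀ g ∈ G, ¬ g ≤ s) := by
    ext s
    simp [Finsupp.degree_eq_sum]
  have hcard := finrank_map_restrictSupport_quotient_span_monomial (k := k) G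
    {s : Fin 4 →₀ ℕ | s.degree = i}
  rw [← hspan] at hcard
  rw [homogeneousSubmodule_eq_finsupp_supported]
  refine (congrArg Nat.cast hcard).trans ?_
  rw [hset, Nat.card_coe_set_eq, Set.ncard_coe_finset, ← Finset.sum_boole,
    Finset.sum_congr rfl fun s _ => (if_congr (hstd s) rfl rfl).trans
      (indicator_staircase (by omega) (by omega) (by omega))]
  simp only [Finset.sum_add_distrib, Finset.sum_sub_distrib, sum_ite_expVec_le]
  simp only [Nat.cast_zero, sub_zero]
  ring_nf
end

section
/- Suppose I(C) is generated by the five Case 1(b) binomials f1 = x1^{a1} − x3^{a13}x4^{a14}, f2 = x2^{a2} − x1^{a21}x3^{a23}, f3 = x3^{a3} − x2^{a32}x4^{a34}, f4 = x4^{a4} − x1^{a41}x2^{a42}, f5 = x2^{a42}x3^{a13} − x1^{a21}x4^{a34}, where n1 < n2 < n3 < n4, a2 ≤ a21 + a23 and a3 ≤ a32 + a34. Then the ideal I(C)_* of initial forms is generated by one of the following four sets: {x3^{a13}x4^{a14}, x2^{a2}, x3^{a3}, x4^{a4}, x2^{a42}x3^{a13}}, {x3^{a13}x4^{a14}, x2^{a2}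 − x1^{a21}x3^{a23}, x3^{a3}, x4^{a4}, x2^{a42}x3^{a13}}, {x3^{a13}x4^{a14}, x2^{a2}, x3^{a3} − x2^{a32}x4^{a34}, x4^{a4}, x2^{a42}x3^{a13}}, or {x3^{a13}x4^{a14}, x2^{a2} − x1^{a21}x3^{a23}, x3^{a3} − x2^{a32}x4^{a34}, x4^{a4}, x1^{a21}x4^{a34} − x2^{a42}x3^{a13}}; in particular I(C)_* is minimally generated by five elements. -/
open MvPolynomial

/-- The initial form `f_*` of a multivariate polynomial `f`: the homogeneous
component of `f` of least degree (for `f = 0` this is `0`). -/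
noncomputable def initialForm {k : Type*} [Field k]
    (f : MvPolynomial (Fin 4) k) : MvPolynomial (Fin 4) k :=
  homogeneousComponent (sInf {n | homogeneousComponent n f ≠ 0}) f

open Relation in
/-- **Newman's lemma**: a terminating, locally confluent relation has unique normal forms. -/
theorem exists_normalForm {α : Type*} {r : α → α → Prop} (hwf : WellFounded (flip r))
    (hlc : ∀ a b c, r a b → r a c → Join (ReflTransGen r) b c) :
    ∃ nf : α → α, (∀ a, ReflTransGen r a (nf a)) ∧ ∀ a b, r a b → nf a = nf b := by
  have confl : ∀ a b c, ReflTransGen r a b → ReflTransGen r a c →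
      Join (ReflTransGen r) b c := by
    intro a
    induction a using hwf.induction with
    | _ a ih =>
      intro b c hab hac
      rcases hab.cases_head with rfl | ⟨b', hb', hb⟩
      · exact ⟨c, hac, .refl⟩
      rcases hac.cases_head with rfl | ⟨c', hc', hc⟩
      · exact ⟨b, .refl, hab⟩
      obtain ⟨d, hbd, hcd⟩ := hlc a b' c' hb' hc'
      obtain ⟨e, hbe, hde⟩ := ih b' hb' b d hb hbd
      obtain ⟨f, hcf, hef⟩ := ih c' hc' c e hc (hcd.trans hde)
      exact ⟨f, hbe.trans hef, hcf⟩
  have exists_nf : ∀ a, ∃ u, ReflTransGen r a u ∧ ∀ v, ¬ r u v := by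
    intro a
    induction a using hwf.induction with
    | _ a ih =>
      by_cases h : ∃ b, r a b
      · obtain ⟨b, hb⟩ := h
        obtain ⟨u, hu, hn⟩ := ih b hb
        exact ⟨u, .head hb hu, hn⟩
      · exact ⟨a, .refl, not_exists.mp h⟩
  choose nf hred hnf using exists_nf
  refine ⟨nf, hred, fun a b hab => ?_⟩
  obtain ⟨w, h1, h2⟩ := confl a _ _ (hred a) (.head hab (hred b))
  rcases h1.cases_head with h1 | ⟨v, hv, -⟩
  · rcases h2.cases_head with h2 | ⟨v, hv, -⟩
    · exact h1.trans h2.symm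
    · exact (hnf _ _ hv).elim
  · exact (hnf _ _ hv).elim

/-- The rewriting relation on exponents which replaces a factor `L i` of a monomial by `R i`. -/
def RewriteStep {ι : Type*} (L R : ι → Fin 4 →₀ ℕ) (m m' : Fin 4 →₀ ℕ) : Prop :=
  ∃ i c, m = c + L i ∧ m' = c + R i

/-- The initial form of `x ^ u - x ^ v`, provided that `u ≠ v` and `u.degree ≤ v.degree`. -/
noncomputable def binomialInitialForm (k : Type*) [Field k] (u v : Fin 4 →₀ ℕ) :
    MvPolynomial (Fin 4) k :=
  monomial u 1 - if u.degree = v.degree then monomial v 1 else 0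

section InitialForm

variable {k : Type*} [Field k] {ι : Type*} {L R : ι → Fin 4 →₀ ℕ}

theorem initialForm_eq_homogeneousComponent {f : MvPolynomial (Fin 4) k} {n : ℕ}
    (hn : homogeneousComponent n f ≠ 0) (hlt : ∀ i < n, homogeneousComponent i f = 0) :
    initialForm f = homogeneousComponent n f := by
  have : sInf {n | homogeneousComponent n f ≠ 0} = n :=
    le_antisymm (Nat.sInf_le hn) (le_csInf ⟨n, hn⟩ fun b hb => not_lt.mp fun h => hb (hlt b h))
  rw [initialForm, this]

theorem homogeneousComponent_monomial_one (n : ℕ) (u : Fin 4 →₀ ℕ) :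
    homogeneousComponent n (monomial u (1 : k)) = if u.degree = n then monomial u 1 else 0 := by
  classical
  ext d
  rw [coeff_homogeneousComponent]
  split_ifs with h1 h2 h2 <;> simp only [coeff_monomial, coeff_zero] <;> grind

theorem initialForm_binomial {u v : Fin 4 →₀ ℕ} (huv : u ≠ v) (hdeg : u.degree ≤ v.degree) :
    initialForm (monomial u 1 - monomial v 1 : MvPolynomial (Fin 4) k) =
      binomialInitialForm k u v := by
  classical
  have key : homogeneousComponent u.degree (monomial u 1 - monomial v 1 : MvPolynomial (Fin 4) k) =
      binomialInitialForm k u v := by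
    simp [homogeneousComponent_monomial_one, binomialInitialForm, eq_comm]
  rw [initialForm_eq_homogeneousComponent (n := u.degree) _ _, key]
  · rw [key]
    intro h
    have := congrArg (coeff u) h
    unfold binomialInitialForm at this
    split_ifs at this <;> simp [coeff_monomial, huv.symm] at this
  · intro i hi
    simp [homogeneousComponent_monomial_one, hi.ne', (hi.trans_le hdeg).ne']

theorem binomialInitialForm_add_left (c u v : Fin 4 →₀ ℕ) :
    binomialInitialForm k (c + u) (c + v) = monomial c 1 * binomialInitialForm k u v := by
  unfold binomialInitialForm
  simp only [map_add, add_right_inj, mul_sub, monomial_mul, mul_one, mul_ite, mul_zero]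

theorem binomialInitialForm_mem_of_reflTransGen (hdeg : ∀ i, (L i).degree ≤ (R i).degree)
    {m m' : Fin 4 →₀ ℕ} (h : Relation.ReflTransGen (RewriteStep L R) m m') :
    m.degree ≤ m'.degree ∧ binomialInitialForm k m m' ∈
      Ideal.span (Set.range fun i => binomialInitialForm k (L i) (R i)) := by
  induction h with
  | refl => simp [binomialInitialForm]
  | @tail b c _ hbc ih =>
    obtain ⟨hle, hmem⟩ := ih
    obtain ⟨i, d, rfl, rfl⟩ := hbc
    have hle' : (d + L i).degree ≤ (d + R i).degree := by simpa using hdeg i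
    have hmem' : binomialInitialForm k (d + L i) (d + R i) ∈
        Ideal.span (Set.range fun i => binomialInitialForm k (L i) (R i)) := by
      rw [binomialInitialForm_add_left]
      exact Ideal.mul_mem_left _ _ (Ideal.subset_span ⟨i, rfl⟩)
    refine ⟨hle.trans hle', ?_⟩
    have hsum := Ideal.add_mem _ hmem hmem'
    unfold binomialInitialForm at hmem hsum ⊢
    by_cases h1 : m.degree = (d + L i).degree
    · simpa [h1] using hsum
    · rw [if_neg h1] at hmem
      rwa [if_neg (by omega)]

theorem homogeneousComponent_eq_zero_of_lt_sInf {f : MvPolynomial (Fin 4) k} {i : ℕ}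
    (hi : i < sInf {n | homogeneousComponent n f ≠ 0}) : homogeneousComponent i f = 0 :=
  not_not.mp (Nat.notMem_of_lt_sInf hi)

theorem initialForm_mem_of_locallyConfluent (hdeg : ∀ i, (L i).degree ≤ (R i).degree)
    (hwf : WellFounded (flip (RewriteStep L R)))
    (hlc : ∀ a b c, RewriteStep L R a b → RewriteStep L R a c →
      Relation.Join (Relation.ReflTransGen (RewriteStep L R)) b c)
    {f : MvPolynomial (Fin 4) k}
    (hf : f ∈ Ideal.span (Set.range fun i => (monomial (L i) 1 - monomial (R i) 1 :
      MvPolynomial (Fin 4) k))) :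
    initialForm f ∈ Ideal.span (Set.range fun i => binomialInitialForm k (L i) (R i)) := by
  obtain ⟨nf, hred, hnf⟩ := exists_normalForm hwf hlc
  have hlow := fun i => homogeneousComponent_eq_zero_of_lt_sInf (f := f) (i := i)
  unfold initialForm
  set n := sInf {n | homogeneousComponent n f ≠ 0}
  set J := Ideal.span (Set.range fun i => binomialInitialForm k (L i) (R i))
  let Ψ : MvPolynomial (Fin 4) k →ₗ[k] MvPolynomial (Fin 4) k :=
    (basisMonomials (Fin 4) k).constr k fun m =>
      if (nf m).degree = n then monomial (nf m) 1 else 0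
  have hΨ1 : ∀ m, Ψ (monomial m 1) = if (nf m).degree = n then monomial (nf m) 1 else 0 :=
    fun m => (basisMonomials (Fin 4) k).constr_basis k _ m
  have hmono : ∀ m a, (monomial m a : MvPolynomial (Fin 4) k) = a • monomial m 1 := by
    intro m a
    simp [smul_monomial]
  have hΨ : Ψ f = 0 := by
    have key : ∀ i p, Ψ (p * (monomial (L i) 1 - monomial (R i) 1)) = 0 := by
      intro i p
      induction p using MvPolynomial.induction_on' with
      | monomial u a =>
        rw [hmono, smul_mul_assoc, map_smul, mul_sub, monomial_mul, monomial_mul, map_sub,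
          mul_one, hΨ1, hΨ1, hnf _ _ ⟨i, u, rfl, rfl⟩, sub_self, smul_zero]
      | add p q hp hq => rw [add_mul, map_add, hp, hq, add_zero]
    refine Submodule.span_induction (p := fun x _ => ∀ q, Ψ (q * x) = 0) ?_ ?_ ?_ ?_ hf 1
      |> fun h => by simpa using h
    · rintro _ ⟨i, rfl⟩ q
      exact key i q
    · simp
    · intro x y _ _ hx hy q
      rw [mul_add, map_add, hx, hy, add_zero]
    · intro a x _ hx q
      rw [smul_eq_mul, ← mul_assoc, hx]
  have hdiff : homogeneousComponent n f - Ψ f ∈ J := by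
    nth_rw 2 [f.as_sum]
    rw [homogeneousComponent_apply, Finset.sum_filter, map_sum, ← Finset.sum_sub_distrib]
    refine Ideal.sum_mem _ fun m _ => ?_
    obtain ⟨hle, hmem⟩ := binomialInitialForm_mem_of_reflTransGen (k := k) hdeg (hred m)
    rw [hmono, map_smul, hΨ1]
    rcases lt_trichotomy m.degree n with h | h | h
    · have hc : coeff m f = 0 := by
        have := congrArg (coeff m) (hlow _ h)
        simpa [coeff_homogeneousComponent] using this
      simp [hc]
    · rw [if_pos h, ← smul_sub]
      refine Submodule.smul_of_tower_mem _ _ ?_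
      rw [binomialInitialForm, h] at hmem
      simpa only [eq_comm] using hmem
    · rw [if_neg h.ne', if_neg (h.trans_le hle).ne', smul_zero, sub_zero]
      exact J.zero_mem
  simpa [hΨ] using hdiff

/-- The ideal of initial forms is determined by a terminating, locally confluent rewriting
system whose rules do not decrease the degree. -/
theorem span_initialForm_eq (hne : ∀ i, L i ≠ R i) (hdeg : ∀ i, (L i).degree ≤ (R i).degree)
    (hwf : WellFounded (flip (RewriteStep L R)))
    (hlc : ∀ a b c, RewriteStep L R a b → RewriteStep L R a c →
      Relation.Join (Relation.ReflTransGen (RewriteStep L R)) b c) :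
    Ideal.span {g | ∃ f ∈ Ideal.span (Set.range fun i => (monomial (L i) 1 - monomial (R i) 1 :
      MvPolynomial (Fin 4) k)), g = initialForm f} =
      Ideal.span (Set.range fun i => binomialInitialForm k (L i) (R i)) := by
  apply le_antisymm <;> rw [Ideal.span_le]
  · rintro _ ⟨f, hf, rfl⟩
    exact initialForm_mem_of_locallyConfluent hdeg hwf hlc hf
  · rintro _ ⟨i, rfl⟩
    exact Ideal.subset_span ⟨_, Ideal.subset_span ⟨i, rfl⟩,
      (initialForm_binomial (hne i) (hdeg i)).symm⟩

/-- Local confluence only has to be checked on critical pairs. -/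
theorem join_of_criticalPairs [LinearOrder ι]
    (h : ∀ i j, i < j → ∃ s s' w, s + L i = L i ⊔ L j ∧ s' + L j = L i ⊔ L j ∧
      Relation.ReflTransGen (RewriteStep L R) (s + R i) w ∧
      Relation.ReflTransGen (RewriteStep L R) (s' + R j) w)
    (a b c : Fin 4 →₀ ℕ) (hab : RewriteStep L R a b) (hac : RewriteStep L R a c) :
    Relation.Join (Relation.ReflTransGen (RewriteStep L R)) b c := by
  have hshift : ∀ g {u v : Fin 4 →₀ ℕ}, Relation.ReflTransGen (RewriteStep L R) u v →
      Relation.ReflTransGen (RewriteStep L R) (g + u) (g + v) := fun g u v huv =>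
    huv.lift (g + ·) fun _ _ ⟨i, c, hx, hy⟩ =>
      ⟨i, g + c, by rw [hx, add_assoc], by rw [hy, add_assoc]⟩
  have key : ∀ i j c c', i < j → c + L i = c' + L j →
      Relation.Join (Relation.ReflTransGen (RewriteStep L R)) (c + R i) (c' + R j) := by
    intro i j c c' hij hcc
    obtain ⟨s, s', w, hs, hs', hw, hw'⟩ := h i j hij
    have hle : L i ⊔ L j ≤ c + L i :=
      sup_le le_add_self (hcc ▸ le_add_self)
    obtain ⟨g, hg⟩ := exists_add_of_le hle
    have hc : c = g + s := by
      apply add_right_cancel (b := L i)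
      rw [hg, ← hs]; abel
    have hc' : c' = g + s' := by
      apply add_right_cancel (b := L j)
      rw [← hcc, hg, ← hs']; abel
    exact ⟨g + w, by rw [hc, add_assoc]; exact hshift g hw,
      by rw [hc', add_assoc]; exact hshift g hw'⟩
  obtain ⟨i, d, rfl, rfl⟩ := hab
  obtain ⟨j, d', hd, rfl⟩ := hac
  rcases lt_trichotomy i j with hij | rfl | hij
  · exact key i j d d' hij hd
  · rw [add_right_cancel hd]
    exact ⟨_, .refl, .refl⟩
  · exact Std.Symm.symm _ _ (key j i d' d hij hd.symm)

/-- If no `L j` with `j ≠ i` and no `R j` divides `L i`, then the initial forms of the binomials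
`x ^ L i - x ^ R i` form a minimal generating set. -/
theorem card_le_of_span_eq [Fintype ι] (hL : ∀ i j, L j ≤ L i → i = j) (hR : ∀ i j, ¬ R j ≤ L i)
    (S : Finset (MvPolynomial (Fin 4) k))
    (hS : Ideal.span (S : Set (MvPolynomial (Fin 4) k)) =
      Ideal.span (Set.range fun i => binomialInitialForm k (L i) (R i))) :
    Fintype.card ι ≤ S.card := by
  classical
  let φ : MvPolynomial (Fin 4) k →ₗ[k] (ι → k) := LinearMap.pi fun i => lcoeff k (L i)
  have hφ : ∀ p i, φ p i = coeff (L i) p := fun _ _ => rfl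
  have hgen : ∀ p j, φ (p * binomialInitialForm k (L j) (R j)) =
      coeff 0 p • Pi.single j (1 : k) := by
    intro p j
    ext i
    rw [hφ, binomialInitialForm, mul_sub, coeff_sub]
    have h2 : coeff (L i) (p * if (L j).degree = (R j).degree then monomial (R j) 1 else 0) =
        0 := by
      split_ifs
      · rw [coeff_mul_monomial', if_neg (hR i j)]
      · simp
    rw [h2, coeff_mul_monomial', sub_zero, mul_one]
    by_cases hij : i = j
    · subst hij; simp
    · rw [if_neg fun h => hij (hL i j h)]; simp [hij]
  have hmul : ∀ f ∈ Ideal.span (Set.range fun i => binomialInitialForm k (L i) (R i)),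
      ∀ q, φ (q * f) = coeff 0 q • φ f := by
    intro f hf
    induction hf using Submodule.span_induction with
    | mem x hx =>
      obtain ⟨j, rfl⟩ := hx
      intro q
      have := hgen 1 j
      rw [one_mul] at this
      simp [hgen, this]
    | zero => simp
    | add x y _ _ hx hy => intro q; rw [mul_add, map_add, hx, hy, map_add, smul_add]
    | smul a x _ hx =>
      intro q
      rw [smul_eq_mul, ← mul_assoc, hx, hx, smul_smul, ← constantCoeff_eq, map_mul]
  have hspan : ∀ f ∈ Ideal.span (S : Set (MvPolynomial (Fin 4) k)),
      φ f ∈ Submodule.span k ((S.image φ : Finset (ι → k)) : Set (ι → k)) := by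
    intro f hf
    induction hf using Submodule.span_induction with
    | mem x hx => exact Submodule.subset_span (Finset.mem_coe.mpr (Finset.mem_image_of_mem φ hx))
    | zero => simp
    | add x y _ _ hx hy => rw [map_add]; exact add_mem hx hy
    | smul a x hx' hx =>
      rw [smul_eq_mul, hmul x (hS ▸ hx')]
      exact Submodule.smul_mem _ _ hx
  have htop : Submodule.span k ((S.image φ : Finset (ι → k)) : Set (ι → k)) = ⊤ := by
    rw [eq_top_iff, ← (Pi.basisFun k ι).span_eq, Submodule.span_le]
    rintro _ ⟨j, rfl⟩
    have hj : binomialInitialForm k (L j) (R j) ∈ Ideal.span (S : Set (MvPolynomial (Fin 4) k)) :=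
      hS ▸ Ideal.subset_span ⟨j, rfl⟩
    have := hspan _ hj
    rw [← one_mul (binomialInitialForm k (L j) (R j)), hgen] at this
    simpa using this
  calc Fintype.card ι = Module.finrank k (ι → k) := by simp
    _ = Set.finrank k ((S.image φ : Finset (ι → k)) : Set (ι → k)) := by
      rw [Set.finrank, htop, finrank_top]
    _ ≤ (S.image φ).card := finrank_span_finset_le_card _
    _ ≤ S.card := Finset.card_image_le

end InitialForm

/-- The exponent of the monomial `x₁ ^ a * x₂ ^ b * x₃ ^ c * x₄ ^ d`. -/
noncomputable def exponent (a b c d : ℕ) : Fin 4 →₀ ℕ :=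
  Finsupp.equivFunOnFinite.symm ![a, b, c, d]

section Exponent

@[simp] theorem exponent_zero (a b c d : ℕ) : exponent a b c d 0 = a := rfl
@[simp] theorem exponent_one (a b c d : ℕ) : exponent a b c d 1 = b := rfl
@[simp] theorem exponent_two (a b c d : ℕ) : exponent a b c d 2 = c := rfl
@[simp] theorem exponent_three (a b c d : ℕ) : exponent a b c d 3 = d := rfl

theorem monomial_exponent (k : Type*) [Field k] (a b c d : ℕ) :
    (monomial (exponent a b c d) 1 : MvPolynomial (Fin 4) k) =
      X 0 ^ a * X 1 ^ b * X 2 ^ c * X 3 ^ d := by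
  rw [monomial_eq, Finsupp.prod_fintype _ _ (fun _ => pow_zero _)]
  simp [Fin.prod_univ_four]

@[simp] theorem degree_exponent (a b c d : ℕ) : (exponent a b c d).degree = a + b + c + d := by
  simp [Finsupp.degree_eq_sum, Fin.sum_univ_four]

theorem binomialInitialForm_exponent (k : Type*) [Field k] (a b c d a' b' c' d' : ℕ) :
    binomialInitialForm k (exponent a b c d) (exponent a' b' c' d') =
      X 0 ^ a * X 1 ^ b * X 2 ^ c * X 3 ^ d -
        if a + b + c + d = a' + b' + c' + d' then
          X 0 ^ a' * X 1 ^ b' * X 2 ^ c' * X 3 ^ d' else 0 := by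
  simp only [binomialInitialForm, monomial_exponent, degree_exponent]

theorem exponent_ext {u v : Fin 4 →₀ ℕ} (h0 : u 0 = v 0) (h1 : u 1 = v 1) (h2 : u 2 = v 2)
    (h3 : u 3 = v 3) : u = v := by
  ext i
  fin_cases i <;> assumption

theorem exponent_add (a b c d a' b' c' d' : ℕ) :
    exponent a b c d + exponent a' b' c' d' = exponent (a + a') (b + b') (c + c') (d + d') :=
  exponent_ext rfl rfl rfl rfl

theorem exponent_sup (a b c d a' b' c' d' : ℕ) :
    exponent a b c d ⊔ exponent a' b' c' d' =
      exponent (max a a') (max b b') (max c c') (max d d') :=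
  exponent_ext rfl rfl rfl rfl

theorem exponent_le_iff {a b c d a' b' c' d' : ℕ} :
    exponent a b c d ≤ exponent a' b' c' d' ↔ a ≤ a' ∧ b ≤ b' ∧ c ≤ c' ∧ d ≤ d' := by
  rw [Finsupp.le_def]
  simp [Fin.forall_fin_succ]

theorem exponent_inj {a b c d a' b' c' d' : ℕ} :
    exponent a b c d = exponent a' b' c' d' ↔ a = a' ∧ b = b' ∧ c = c' ∧ d = d' := by
  refine ⟨fun h => ⟨?_, ?_, ?_, ?_⟩, fun ⟨h0, h1, h2, h3⟩ => by rw [h0, h1, h2, h3]⟩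
  · exact DFunLike.congr_fun h 0
  · exact DFunLike.congr_fun h 1
  · exact DFunLike.congr_fun h 2
  · exact DFunLike.congr_fun h 3

end Exponent

section Rules

/-- The exponents of the monomials `x₃^a₁₃ x₄^a₁₄, x₂^a₂, x₃^a₃, x₄^a₄, x₂^a₄₂ x₃^a₁₃`. -/
noncomputable def lhs (a32 a42 a13 a23 a14 a34 : ℕ) : Fin 5 → Fin 4 →₀ ℕ :=
  ![exponent 0 0 a13 a14, exponent 0 (a32 + a42) 0 0, exponent 0 0 (a13 + a23) 0,
    exponent 0 0 0 (a14 + a34), exponent 0 a42 a13 0]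

/-- The exponents of the monomials
`x₁^a₁, x₁^a₂₁ x₃^a₂₃, x₂^a₃₂ x₄^a₃₄, x₁^a₄₁ x₂^a₄₂, x₁^a₂₁ x₄^a₃₄`. -/
noncomputable def rhs (a21 a41 a32 a42 a23 a34 : ℕ) : Fin 5 → Fin 4 →₀ ℕ :=
  ![exponent (a21 + a41) 0 0 0, exponent a21 0 a23 0, exponent 0 a32 0 a34,
    exponent a41 a42 0 0, exponent a21 0 0 a34]

variable {n1 n2 n3 n4 a21 a41 a32 a42 a13 a23 a14 a34 : ℕ}

theorem lhs_antichain (h32 : 0 < a32) (h42 : 0 < a42) (h13 : 0 < a13) (h23 : 0 < a23)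
    (h14 : 0 < a14) (h34 : 0 < a34) (i j : Fin 5)
    (h : lhs a32 a42 a13 a23 a14 a34 j ≤ lhs a32 a42 a13 a23 a14 a34 i) : i = j := by
  fin_cases i <;> fin_cases j <;> simp [lhs, exponent_le_iff] at h ⊢ <;> omega

theorem not_rhs_le_lhs (h21 : 0 < a21) (h41 : 0 < a41) (h32 : 0 < a32) (h34 : 0 < a34)
    (i j : Fin 5) :
    ¬ rhs a21 a41 a32 a42 a23 a34 j ≤ lhs a32 a42 a13 a23 a14 a34 i := by
  intro h
  fin_cases i <;> fin_cases j <;> simp [lhs, rhs, exponent_le_iff] at h <;> omega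

theorem wellFounded_rewriteStep (hn1 : 0 < n1) (h21 : 0 < a21) (h41 : 0 < a41)
    (h13 : 0 < a13)
    (hw0 : n1 * (a21 + a41) = n3 * a13 + n4 * a14)
    (hw1 : n2 * (a32 + a42) = n1 * a21 + n3 * a23)
    (hw2 : n3 * (a13 + a23) = n2 * a32 + n4 * a34) :
    WellFounded (flip (RewriteStep (lhs a32 a42 a13 a23 a14 a34)
      (rhs a21 a41 a32 a42 a23 a34))) := by
  let W : (Fin 4 →₀ ℕ) → ℕ := fun m => n1 * m 0 + n2 * m 1 + n3 * m 2 + n4 * m 3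
  have hle : ∀ m, m 0 ≤ W m := fun m => by
    have := Nat.le_mul_of_pos_left (m 0) hn1
    simp only [W]
    omega
  refine Subrelation.wf (r := InvImage (Prod.Lex (· < ·) (· < ·)) fun m => (W m - m 0, m 2)) ?_
    (InvImage.wf _ (WellFounded.prod_lex wellFounded_lt wellFounded_lt))
  rintro m' m ⟨i, c, rfl, rfl⟩
  have hW : W (c + rhs a21 a41 a32 a42 a23 a34 i) = W (c + lhs a32 a42 a13 a23 a14 a34 i) := by
    fin_cases i <;> simp [lhs, rhs, W] <;> linarith
  have hle' := hle (c + rhs a21 a41 a32 a42 a23 a34 i)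
  simp only [InvImage, Prod.lex_def]
  rw [hW] at hle' ⊢
  generalize W (c + lhs a32 a42 a13 a23 a14 a34 i) = w at hle' ⊢
  fin_cases i <;> simp [lhs, rhs] at hle' ⊢ <;> omega

theorem join_rewriteStep (a b c : Fin 4 →₀ ℕ)
    (hab : RewriteStep (lhs a32 a42 a13 a23 a14 a34) (rhs a21 a41 a32 a42 a23 a34) a b)
    (hac : RewriteStep (lhs a32 a42 a13 a23 a14 a34) (rhs a21 a41 a32 a42 a23 a34) a c) :
    Relation.Join (Relation.ReflTransGen
      (RewriteStep (lhs a32 a42 a13 a23 a14 a34) (rhs a21 a41 a32 a42 a23 a34))) b c := by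
  set L := lhs a32 a42 a13 a23 a14 a34 with hL
  set R := rhs a21 a41 a32 a42 a23 a34 with hR
  have coprime : ∀ i j, L i + L j = L i ⊔ L j → ∃ s s' w, s + L i = L i ⊔ L j ∧
      s' + L j = L i ⊔ L j ∧ Relation.ReflTransGen (RewriteStep L R) (s + R i) w ∧
      Relation.ReflTransGen (RewriteStep L R) (s' + R j) w := fun i j h =>
    ⟨L j, L i, R i + R j, by rw [← h, add_comm], h,
      .single ⟨j, R i, add_comm _ _, rfl⟩, .single ⟨i, R j, add_comm _ _, add_comm _ _⟩⟩
  have step : ∀ i s {u v}, u = s + L i → v = s + R i →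
      Relation.ReflTransGen (RewriteStep L R) u v := fun i s _ _ hu hv => .single ⟨i, s, hu, hv⟩
  have done : ∀ {u v}, u = v → Relation.ReflTransGen (RewriteStep L R) u v := fun h => h ▸ .refl
  refine join_of_criticalPairs (fun i j hij => ?_) a b c hab hac
  fin_cases i <;> fin_cases j <;> try exact absurd hij (by decide)
  · exact coprime 0 1 (by simp [hL, lhs, exponent_add, exponent_sup])
  · refine ⟨exponent 0 0 a23 0, exponent 0 0 0 a14, exponent (a21 + a41) 0 a23 0, ?_, ?_, done ?_,
      (step 3 (exponent 0 a32 0 0) ?_ rfl).trans (step 1 (exponent a41 0 0 0) ?_ ?_)⟩ <;>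
    simp [hL, hR, lhs, rhs, exponent_add, exponent_sup, exponent_inj] <;> omega
  · refine ⟨exponent 0 0 0 a34, exponent 0 0 a13 0, exponent (a21 + a41) 0 0 a34, ?_, ?_, done ?_,
      step 4 (exponent a41 0 0 0) ?_ ?_⟩ <;>
    simp [hL, hR, lhs, rhs, exponent_add, exponent_sup, exponent_inj] <;> omega
  · refine ⟨exponent 0 a42 0 0, exponent 0 0 0 a14, exponent (a21 + a41) a42 0 0, ?_, ?_, done ?_,
      step 3 (exponent a21 0 0 0) ?_ ?_⟩ <;>
    simp [hL, hR, lhs, rhs, exponent_add, exponent_sup]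
  · exact coprime 1 2 (by simp [hL, lhs, exponent_add, exponent_sup])
  · exact coprime 1 3 (by simp [hL, lhs, exponent_add, exponent_sup])
  · refine ⟨exponent 0 0 a13 0, exponent 0 a32 0 0, exponent a21 a32 0 a34, ?_, ?_,
      step 2 (exponent a21 0 0 0) ?_ ?_, done ?_⟩ <;>
    simp [hL, hR, lhs, rhs, exponent_add, exponent_sup]
  · exact coprime 2 3 (by simp [hL, lhs, exponent_add, exponent_sup])
  · refine ⟨exponent 0 a42 0 0, exponent 0 0 a23 0, exponent a21 0 a23 a34, ?_, ?_,
      step 1 (exponent 0 0 0 a34) ?_ ?_, done ?_⟩ <;>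
    simp [hL, hR, lhs, rhs, exponent_add, exponent_sup, exponent_inj] <;> omega
  · exact coprime 3 4 (by simp [hL, lhs, exponent_add, exponent_sup])

end Rules

theorem sum_mul_eq_of_mem_ker {k : Type*} [Field k] (n : Fin 4 → ℕ) {u v : Fin 4 →₀ ℕ}
    (h : (monomial u 1 - monomial v 1 : MvPolynomial (Fin 4) k) ∈ RingHom.ker
      (aeval (fun i => (Polynomial.X : Polynomial k) ^ n i) :
        MvPolynomial (Fin 4) k →ₐ[k] Polynomial k)) :
    ∑ i, n i * u i = ∑ i, n i * v i := by
  rw [RingHom.mem_ker, map_sub, sub_eq_zero, aeval_monomial, aeval_monomial,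
    Finsupp.prod_fintype _ _ (fun _ => pow_zero _),
    Finsupp.prod_fintype _ _ (fun _ => pow_zero _)] at h
  simp only [← pow_mul, Finset.prod_pow_eq_pow_sum, map_one, one_mul] at h
  simpa using congrArg Polynomial.natDegree h

theorem Ideal.span_range_fin_five {A : Type*} [CommRing A] (g : Fin 5 → A) :
    Ideal.span (Set.range g) = Ideal.span {g 0, g 1, g 2, g 3, g 4} := by
  congr 1
  ext x
  simp [Fin.exists_fin_succ, eq_comm]

theorem tangent_cone_generators_case_1b
    (k : Type*) [Field k]
    (n1 n2 n3 n4 : ℕ)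
    (hn1 : 0 < n1) (hn12 : n1 < n2) (hn23 : n2 < n3) (hn34 : n3 < n4)
    (hgcd : Nat.gcd (Nat.gcd (Nat.gcd n1 n2) n3) n4 = 1)
    (a21 a41 a32 a42 a13 a23 a14 a34 a1 a2 a3 a4 : ℕ)
    (h21 : 0 < a21) (h41 : 0 < a41) (h32 : 0 < a32) (h42 : 0 < a42)
    (h13 : 0 < a13) (h23 : 0 < a23) (h14 : 0 < a14) (h34 : 0 < a34)
    (ha1 : a1 = a21 + a41)
    (ha2 : a2 = a32 + a42)
    (ha3 : a3 = a13 + a23)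
    (ha4 : a4 = a14 + a34)
    (hb21 : a21 < a1) (hb41 : a41 < a1) (hb32 : a32 < a2) (hb42 : a42 < a2)
    (hb13 : a13 < a3) (hb23 : a23 < a3) (hb14 : a14 < a4) (hb34 : a34 < a4)
    (hc1 : a2 ≤ a21 + a23)
    (hc2 : a3 ≤ a32 + a34)
    (x1 x2 x3 x4 : MvPolynomial (Fin 4) k)
    (hx1 : x1 = X 0) (hx2 : x2 = X 1) (hx3 : x3 = X 2) (hx4 : x4 = X 3)
    (IC : Ideal (MvPolynomial (Fin 4) k))
    (hIC : IC = RingHom.ker (aeval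
      (fun i : Fin 4 => (Polynomial.X : Polynomial k) ^ (![n1, n2, n3, n4] i)) :
        MvPolynomial (Fin 4) k →ₐ[k] Polynomial k))
    (hgen : IC = Ideal.span {x1 ^ a1 - x3 ^ a13 * x4 ^ a14,
      x2 ^ a2 - x1 ^ a21 * x3 ^ a23,
      x3 ^ a3 - x2 ^ a32 * x4 ^ a34,
      x4 ^ a4 - x1 ^ a41 * x2 ^ a42,
      x2 ^ a42 * x3 ^ a13 - x1 ^ a21 * x4 ^ a34})
    (Istar : Ideal (MvPolynomial (Fin 4) k))
    (hIstar : Istar = Ideal.span {g | ∃ f ∈ IC, g = initialForm f}) :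
    (Istar = Ideal.span {x3 ^ a13 * x4 ^ a14, x2 ^ a2, x3 ^ a3, x4 ^ a4, x2 ^ a42 * x3 ^ a13} ∨
      Istar = Ideal.span {x3 ^ a13 * x4 ^ a14, x2 ^ a2 - x1 ^ a21 * x3 ^ a23, x3 ^ a3, x4 ^ a4, x2 ^ a42 * x3 ^ a13} ∨
      Istar = Ideal.span {x3 ^ a13 * x4 ^ a14, x2 ^ a2, x3 ^ a3 - x2 ^ a32 * x4 ^ a34, x4 ^ a4, x2 ^ a42 * x3 ^ a13} ∨
      Istar = Ideal.span {x3 ^ a13 * x4 ^ a14, x2 ^ a2 - x1 ^ a21 * x3 ^ a23, x3 ^ a3 - x2 ^ a32 * x4 ^ a34, x4 ^ a4, x1 ^ a21 * x4 ^ a34 - x2 ^ a42 * x3 ^ a13}) ∧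
    (∃ S : Finset (MvPolynomial (Fin 4) k), S.card = 5 ∧
      Ideal.span (S : Set (MvPolynomial (Fin 4) k)) = Istar) ∧
    (∀ S : Finset (MvPolynomial (Fin 4) k),
      Ideal.span (S : Set (MvPolynomial (Fin 4) k)) = Istar → 5 ≤ S.card) := by
  subst ha1 ha2 ha3 ha4 hx1 hx2 hx3 hx4
  set L := lhs a32 a42 a13 a23 a14 a34 with hL
  set R := rhs a21 a41 a32 a42 a23 a34 with hR
  have hIC' : IC = Ideal.span (Set.range fun i =>
      (monomial (L i) 1 - monomial (R i) 1 : MvPolynomial (Fin 4) k)) := by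
    rw [hgen, Ideal.span_range_fin_five]
    simp only [Ideal.span_insert]
    rw [← Ideal.span_singleton_neg (X 0 ^ (a21 + a41) - _), neg_sub]
    simp [hL, hR, lhs, rhs, monomial_exponent]
  have hweight := fun i => sum_mul_eq_of_mem_ker ![n1, n2, n3, n4] (u := L i) (v := R i)
    (by rw [← hIC, hIC']; exact Ideal.subset_span ⟨i, rfl⟩)
  simp only [Fin.sum_univ_four] at hweight
  have hw0 : n1 * (a21 + a41) = n3 * a13 + n4 * a14 := by
    simpa [hL, hR, lhs, rhs, eq_comm] using hweight 0
  have hw1 : n2 * (a32 + a42) = n1 * a21 + n3 * a23 := by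
    simpa [hL, hR, lhs, rhs] using hweight 1
  have hw2 : n3 * (a13 + a23) = n2 * a32 + n4 * a34 := by
    simpa [hL, hR, lhs, rhs] using hweight 2
  have hdeg0 : a13 + a14 < a21 + a41 := by nlinarith
  have hdeg3 : a14 + a34 < a41 + a42 := by nlinarith
  have hstar : Istar = Ideal.span (Set.range fun i => binomialInitialForm k (L i) (R i)) := by
    rw [hIstar, hIC']
    refine span_initialForm_eq (fun i h => ?_) (fun i => ?_) ?_ join_rewriteStep
    · exact not_rhs_le_lhs h21 h41 h32 h34 i i h.ge
    · fin_cases i <;> simp [hL, hR, lhs, rhs] <;> omega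
    · exact wellFounded_rewriteStep hn1 h21 h41 h13 hw0 hw1 hw2
  have hlower : ∀ S : Finset (MvPolynomial (Fin 4) k),
      Ideal.span (S : Set (MvPolynomial (Fin 4) k)) = Istar → 5 ≤ S.card := fun S hS =>
    card_le_of_span_eq (lhs_antichain h32 h42 h13 h23 h14 h34)
      (not_rhs_le_lhs h21 h41 h32 h34) S (hS.trans hstar)
  refine ⟨?_, ?_, hlower⟩
  · rw [hstar, Ideal.span_range_fin_five]
    simp only [hL, hR, lhs, rhs]
    by_cases e1 : a32 + a42 = a21 + a23 <;> by_cases e2 : a13 + a23 = a32 + a34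
    · refine Or.inr <| Or.inr <| Or.inr ?_
      have e4 : a42 + a13 = a21 + a34 := by omega
      simp only [Ideal.span_insert]
      rw [← Ideal.span_singleton_neg (X 0 ^ a21 * X 3 ^ a34 - _), neg_sub]
      simp [binomialInitialForm_exponent, hdeg0.ne, hdeg3.ne, e1, e2, e4]
    · refine Or.inr <| Or.inl ?_
      have e4 : a42 + a13 ≠ a21 + a34 := by omega
      simp [binomialInitialForm_exponent, hdeg0.ne, hdeg3.ne, e1, e2, e4]
    · refine Or.inr <| Or.inr <| Or.inl ?_
      have e4 : a42 + a13 ≠ a21 + a34 := by omega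
      simp [binomialInitialForm_exponent, hdeg0.ne, hdeg3.ne, e1, e2, e4]
    · refine Or.inl ?_
      have e4 : a42 + a13 ≠ a21 + a34 := by omega
      simp [binomialInitialForm_exponent, hdeg0.ne, hdeg3.ne, e1, e2, e4]
  · classical
    have hS : Ideal.span ((Finset.univ.image fun i => binomialInitialForm k (L i) (R i) :
        Finset (MvPolynomial (Fin 4) k)) : Set (MvPolynomial (Fin 4) k)) = Istar := by
      rw [hstar, Finset.coe_image, Finset.coe_univ, Set.image_univ]
    exact ⟨_, le_antisymm Finset.card_image_le (hlower _ hS), hS⟩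
end
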